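/- Let X be a finite connected multigraph with vertices v₁, ..., v_s, and fix two distinct vertices v_{r+1}, v_{r+2}. Let L = Val(X) − A(X) be the Laplacian (Val the diagonal degree matrix, A the adjacency matrix with a_{ii} = twice the number of loops at v_i and a_{ij} = number of edges between v_i and v_j for i ≠ j), and let M be the (s−2)×(s−2) matrix obtained from L by deleting the two rows and two columns indexed by v_{r+1} and v_{r+2}. Then det(M) equals the number of spanning 2-forests of X consisting of two trees, one containing v_{r+1} and the other containing v_{r+2}. -/

import Mathlib

structure Multigraph where
  V : Type
  E : Type
  [fintypeV : Fintype V]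
  [fintypeE : Fintype E]
  [decEqV : DecidableEq V]
  ends : E → Sym2 V

attribute [instance] Multigraph.fintypeV Multigraph.fintypeE Multigraph.decEqV

namespace Multigraph

variable (G : Multigraph)

/-- Reachability in the spanning subgraph using only the edges in `S`. -/
def Reach (S : Set G.E) : G.V → G.V → Prop :=
  Relation.ReflTransGen (fun x y => ∃ e ∈ S, G.ends e = s(x, y))

/-- The multigraph is connected. -/
def Connected : Prop := ∀ x y : G.V, G.Reach Set.univ x y

/-- The edge set `S` is acyclic: every edge of `S` is a bridge of `S`. -/
def IsForest (S : Finset G.E) : Prop :=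
  ∀ e ∈ S, ∀ x y : G.V, G.ends e = s(x, y) → ¬ G.Reach ((↑S : Set G.E) \ {e}) x y

/-- `S` is the edge set of a spanning tree. -/
def IsSpanningTree (S : Finset G.E) : Prop :=
  G.IsForest S ∧ ∀ x y : G.V, G.Reach ↑S x y

/-- `S` is the edge set of a spanning 2-forest consisting of two trees, one
containing `u`, the other containing `v`, whose vertex sets partition the vertices. -/
def IsTwoForest (u v : G.V) (S : Finset G.E) : Prop :=
  G.IsForest S ∧ ¬ G.Reach ↑S u v ∧ ∀ x : G.V, G.Reach ↑S u x ∨ G.Reach ↑S v x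

/-- The number of spanning trees. -/
noncomputable def treeCount : ℕ :=
  Nat.card {S : Finset G.E // G.IsSpanningTree S}

/-- The number of spanning 2-forests separating `u` and `v`. -/
noncomputable def twoForestCount (u v : G.V) : ℕ :=
  Nat.card {S : Finset G.E // G.IsTwoForest u v S}

end Multigraph

namespace Multigraph

variable (G : Multigraph)

/-- The number of edges whose set of endpoints is `{x, y}` (for `x = y`, the number of
loops at `x`). -/
noncomputable def numEdges (x y : G.V) : ℕ :=
  Nat.card {e : G.E // G.ends e = s(x, y)}

/-- The degree (valency) of a vertex, with each loop counted twice. -/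
noncomputable def degree (x : G.V) : ℕ :=
  (∑ y : G.V, G.numEdges x y) + G.numEdges x x

/-- The diagonal valency matrix `Val(X)`. -/
noncomputable def valMatrix : Matrix G.V G.V ℤ :=
  fun x y => if x = y then (G.degree x : ℤ) else 0

/-- The adjacency matrix `A(X)`: `a_{ii}` is twice the number of loops at `v_i` and
`a_{ij}` is the number of edges between `v_i` and `v_j` for `i ≠ j`. -/
noncomputable def adjMatrix : Matrix G.V G.V ℤ :=
  fun x y => if x = y then 2 * (G.numEdges x x : ℤ) else (G.numEdges x y : ℤ)

/-- The Laplacian `L = Val(X) − A(X)`. -/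
noncomputable def lapMatrix : Matrix G.V G.V ℤ :=
  G.valMatrix - G.adjMatrix

end Multigraph

namespace Multigraph

open Classical in
/-- The other end of `e` seen from `x` (and `x` itself if `x` is not an end of `e`). -/
noncomputable def oth (G : Multigraph) (e : G.E) (x : G.V) : G.V :=
  if h : x ∈ G.ends e then Sym2.Mem.other h else x

theorem oth_eq_iff (G : Multigraph) (e : G.E) {x y : G.V} (hxy : x ≠ y) :
    G.oth e x = y ↔ G.ends e = s(x, y) := by
  unfold oth
  split_ifs with h
  · constructor
    · rintro rfl
      exact (Sym2.other_spec h).symm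
    · intro h2
      have h3 := Sym2.other_spec h
      exact Sym2.congr_right.1 (h3.trans h2)
  · constructor
    · intro h2; exact absurd h2 hxy
    · intro h2
      exact absurd (by rw [h2]; exact Sym2.mem_mk_left x y) h

open Classical in
theorem lap_row (G : Multigraph) (x y : G.V) :
    G.lapMatrix x y = ∑ e : G.E, ((if x = y then (1 : ℤ) else 0) - if G.oth e x = y then 1 else 0) := by
  have hn : ∀ z, x ≠ z → (G.numEdges x z : ℤ) = ∑ e : G.E, if G.oth e x = z then (1 : ℤ) else 0 := by
    intro z hz
    rw [numEdges, Nat.card_eq_fintype_card, Fintype.card_subtype, Finset.sum_boole]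
    congr 2
    ext e
    simp [oth_eq_iff G e hz]
  by_cases hxy : x = y
  · subst hxy
    simp only [lapMatrix, valMatrix, adjMatrix, Matrix.sub_apply, if_true, degree]
    rw [Finset.sum_sub_distrib]
    have h1 : ∑ e : G.E, (1 : ℤ) = ∑ z : G.V, ∑ e : G.E, if G.oth e x = z then (1 : ℤ) else 0 := by
      rw [Finset.sum_comm]
      simp
    rw [h1]
    push_cast
    rw [← Finset.add_sum_erase _ _ (Finset.mem_univ x),
      ← Finset.add_sum_erase (a := x) (f := fun z => ∑ e : G.E, if G.oth e x = z then (1 : ℤ) else 0)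
        _ (Finset.mem_univ x)]
    rw [Finset.sum_congr rfl (fun z hz => hn z (Finset.ne_of_mem_erase hz).symm)]
    ring
  · simp only [lapMatrix, valMatrix, adjMatrix, Matrix.sub_apply, if_neg hxy, zero_sub]
    rw [hn y hxy, Finset.sum_neg_distrib]

open Classical in
/-- The determinant of `1 - P`, with `P` the matrix of a functional graph. -/
theorem det_functional {V : Type} [Fintype V] [DecidableEq V] (p : V → Prop) (g : V → V)
    (hg : ∀ x, ¬ p x → g x = x) :
    (Matrix.of (fun x y : {x // p x} => (if x.1 = y.1 then (1 : ℤ) else 0)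
      - if g x.1 = y.1 then 1 else 0)).det =
      if ∀ x, ∃ n, ¬ p (g^[n] x) then 1 else 0 := by
  set P : Matrix {x // p x} {x // p x} ℤ := Matrix.of fun x y => if g x.1 = y.1 then 1 else 0 with hP
  have hM : (Matrix.of (fun x y : {x // p x} => (if x.1 = y.1 then (1 : ℤ) else 0)
      - if g x.1 = y.1 then 1 else 0)) = 1 - P := by
    ext x y
    simp [hP, Matrix.one_apply, Subtype.ext_iff]
  rw [hM]
  have hfix : ∀ x, ¬ p x → ∀ n, g^[n] x = x := by
    intro x hx n
    exact Function.iterate_fixed (hg x hx) n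
  split_ifs with h
  · have hpow : ∀ n, ∀ x y, (P ^ n) x y = if g^[n] x.1 = y.1 then 1 else 0 := by
      intro n
      induction n with
      | zero =>
        intro x y
        rw [pow_zero, Matrix.one_apply]
        exact if_congr Subtype.ext_iff rfl rfl
      | succ n ih =>
        intro x y
        rw [pow_succ', Matrix.mul_apply]
        simp only [ih]
        by_cases hx : p (g x.1)
        · rw [Finset.sum_eq_single ⟨g x.1, hx⟩]
          · simp only [hP, Matrix.of_apply, if_true, one_mul]
            exact if_congr Iff.rfl rfl rfl
          · intro z _ hz
            have : g x.1 ≠ z.1 := fun h => hz (Subtype.ext h.symm)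
            simp [hP, this]
          · simp
        · have h5 : ¬ (g^[n + 1] x.1 = y.1) := by
            intro h
            rw [Function.iterate_succ_apply, hfix _ hx] at h
            exact hx (h ▸ y.2)
          rw [if_neg h5]
          apply Finset.sum_eq_zero
          intro z _
          have : g x.1 ≠ z.1 := fun h => hx (h ▸ z.2)
          simp [hP, this]
    choose N hN using h
    have hnil : IsNilpotent P := by
      refine ⟨∑ x, N x, ?_⟩
      ext x y
      rw [hpow, Matrix.zero_apply, if_neg]
      intro h
      have hle : N x.1 ≤ ∑ x, N x := Finset.single_le_sum (f := N) (fun _ _ => Nat.zero_le _) (Finset.mem_univ _)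
      obtain ⟨k, hk⟩ := Nat.exists_eq_add_of_le' hle
      rw [hk, Function.iterate_add_apply, hfix _ (hN x.1)] at h
      exact hN x.1 (h ▸ y.2)
    have h2 := Matrix.isNilpotent_charpoly_sub_pow_of_isNilpotent hnil
    have h3 := sub_eq_zero.1 h2.eq_zero
    have h4 := congrArg (Polynomial.eval 1) h3
    rw [Matrix.eval_charpoly] at h4
    simpa using h4
  · push Not at h
    obtain ⟨x, hx⟩ := h
    apply Matrix.exists_mulVec_eq_zero_iff.1
    refine ⟨fun z => if ∀ n, p (g^[n] z.1) then 1 else 0, ?_, ?_⟩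
    · intro h0
      have := congrFun h0 ⟨x, hx 0⟩
      simp at this
      obtain ⟨n, hn⟩ := this
      exact hn (hx n)
    · ext z
      rw [Matrix.sub_mulVec, Matrix.one_mulVec, Pi.sub_apply, Pi.zero_apply, sub_eq_zero]
      have hiff : (∀ n, p (g^[n] z.1)) ↔ ∀ n, p (g^[n] (g z.1)) := by
        constructor
        · intro h n
          exact h (n+1)
        · intro h n
          cases n with
          | zero => exact z.2
          | succ n => exact h n
      simp only [Matrix.mulVec, dotProduct]
      by_cases hz : p (g z.1)
      · rw [Finset.sum_eq_single ⟨g z.1, hz⟩]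
        · simp only [hP, Matrix.of_apply, if_true, one_mul]
          exact if_congr hiff rfl rfl
        · intro w _ hw
          have : g z.1 ≠ w.1 := fun h => hw (Subtype.ext h.symm)
          simp [hP, this]
        · simp
      · rw [if_neg (fun h => hz (h 1))]
        symm
        apply Finset.sum_eq_zero
        intro w _
        have : g z.1 ≠ w.1 := fun h => hz (h ▸ w.2)
        simp [hP, this]

open Classical in
/-- The pointer map attached to a choice of an edge at every non-root vertex. -/
noncomputable def ptr (G : Multigraph) (p : G.V → Prop) (f : {x // p x} → G.E) (x : G.V) : G.V :=
  if h : p x then G.oth (f ⟨x, h⟩) x else x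

theorem ptr_pos (G : Multigraph) (p : G.V → Prop) (f : {x // p x} → G.E) (x : {x // p x}) :
    G.ptr p f x.1 = G.oth (f x) x.1 := by
  simp [ptr, x.2]

theorem ptr_neg (G : Multigraph) (p : G.V → Prop) (f : {x // p x} → G.E) (x : G.V) (h : ¬ p x) :
    G.ptr p f x = x := by
  simp [ptr, h]

/-- All orbits of the pointer map end in a root. -/
def Good (G : Multigraph) (p : G.V → Prop) (f : {x // p x} → G.E) : Prop :=
  ∀ x, ∃ n, ¬ p ((G.ptr p f)^[n] x)

open Classical in
theorem det_eq_card (G : Multigraph) (p : G.V → Prop) :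
    (G.lapMatrix.submatrix (Subtype.val : {x // p x} → G.V) Subtype.val).det =
      (Nat.card {f : {x // p x} → G.E // G.Good p f} : ℤ) := by
  have h1 : G.lapMatrix.submatrix (Subtype.val : {x // p x} → G.V) Subtype.val =
      fun (x : {x // p x}) => ∑ e : G.E, fun (y : {x // p x}) => ((if x.1 = y.1 then (1 : ℤ) else 0) - if G.oth e x.1 = y.1 then 1 else 0) := by
    ext x y
    rw [Matrix.submatrix_apply, lap_row, Finset.sum_apply]
  rw [h1]
  have h2 := (Matrix.detRowAlternating (R := ℤ) (n := {x // p x})).toMultilinearMap.map_sum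
    (α := fun _ => G.E)
    (fun (x : {x // p x}) (e : G.E) => fun (y : {x // p x}) => ((if x.1 = y.1 then (1 : ℤ) else 0) - if G.oth e x.1 = y.1 then 1 else 0))
  refine h2.trans ?_
  rw [Nat.card_eq_fintype_card, Fintype.card_subtype, ← Finset.sum_boole]
  refine Finset.sum_congr rfl fun f _ => ?_
  have h3 := det_functional p (G.ptr p f) (G.ptr_neg p f)
  refine Eq.trans ?_ (h3.trans (if_congr Iff.rfl rfl rfl))
  refine congrArg Matrix.det ?_
  ext x y
  rw [Matrix.of_apply, ptr_pos]

section good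
variable {G : Multigraph} {p : G.V → Prop} {f : {x // p x} → G.E}

theorem no_cycle (hf : G.Good p f) (x : G.V) (hx : p x) (n : ℕ) :
    (G.ptr p f)^[n + 1] x ≠ x := by
  intro h
  obtain ⟨m, hm⟩ := hf x
  have h1 : (G.ptr p f)^[m * (n + 1)] x = x := by
    rw [mul_comm, Function.iterate_mul]
    exact Function.iterate_fixed h m
  have h2 : m * (n+1) = m * n + m := by ring
  rw [h2, Function.iterate_add_apply, Function.iterate_fixed (G.ptr_neg p f _ hm)] at h1
  exact hm (by rw [h1]; exact hx)

theorem good_ends (hf : G.Good p f) (x : {x // p x}) :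
    G.ends (f x) = s(x.1, G.ptr p f x.1) := by
  have h := no_cycle hf x.1 x.2 0
  rw [← G.oth_eq_iff (f x) (by simpa using h.symm), ptr_pos]

theorem good_inj (hf : G.Good p f) : Function.Injective f := by
  intro x z hxz
  by_contra hne
  have h1 := good_ends hf x
  have h2 := good_ends hf z
  rw [hxz, h2, Sym2.eq_iff] at h1
  rcases h1 with ⟨h, _⟩ | ⟨h, h'⟩
  · exact hne (Subtype.ext h.symm)
  · apply no_cycle hf x.1 x.2 1
    simp [← h, h']

theorem reach_mono {S T : Set G.E} (h : S ⊆ T) {x y : G.V} (hr : G.Reach S x y) : G.Reach T x y :=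
by
  induction hr with
  | refl => exact Relation.ReflTransGen.refl
  | tail _ h2 ih =>
    obtain ⟨e, he, h3⟩ := h2
    exact Relation.ReflTransGen.tail ih ⟨e, h he, h3⟩

theorem reach_symm {S : Set G.E} {x y : G.V} (hr : G.Reach S x y) : G.Reach S y x :=
by
  induction hr with
  | refl => exact Relation.ReflTransGen.refl
  | tail _ h2 ih =>
    obtain ⟨e, he, h3⟩ := h2
    exact Relation.ReflTransGen.head ⟨e, he, by rw [h3, Sym2.eq_swap]⟩ ih

theorem reach_iterate (hf : G.Good p f) (x : G.V) (n : ℕ) :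
    G.Reach (Set.range f) x ((G.ptr p f)^[n] x) := by
  induction n with
  | zero => exact Relation.ReflTransGen.refl
  | succ n ih =>
    rw [Function.iterate_succ_apply']
    by_cases h : p ((G.ptr p f)^[n] x)
    · exact Relation.ReflTransGen.tail ih ⟨f ⟨_, h⟩, ⟨_, rfl⟩, good_ends hf ⟨_, h⟩⟩
    · rwa [G.ptr_neg p f _ h]

/-- A set of vertices closed under the edges in `S` is closed under reachability. -/
theorem reach_closed {S : Set G.E} (C : G.V → Prop)
    (hC : ∀ e ∈ S, ∃ a b, G.ends e = s(a, b) ∧ (C a ↔ C b)) {x y : G.V}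
    (hr : G.Reach S x y) (hx : C x) : C y := by
  induction hr with
  | refl => exact hx
  | tail _ h ih =>
    obtain ⟨e, he, h⟩ := h
    obtain ⟨a, b, hab, hiff⟩ := hC e he
    rw [h, Sym2.eq_iff] at hab
    rcases hab with ⟨rfl, rfl⟩ | ⟨rfl, rfl⟩
    · exact hiff.1 ih
    · exact hiff.2 ih

theorem good_forest [DecidableEq G.E] (hf : G.Good p f) (S : Finset G.E) (hS : (S : Set G.E) = Set.range f) :
    G.IsForest S := by
  intro e he x y hxy hr
  rw [← Finset.mem_coe, hS] at he
  obtain ⟨z, rfl⟩ := he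
  rw [good_ends hf z, Sym2.eq_iff] at hxy
  have hr' : G.Reach ((↑S : Set G.E) \ {f z}) z.1 (G.ptr p f z.1) := by
    rcases hxy with ⟨rfl, rfl⟩ | ⟨h1, h2⟩
    · exact hr
    · rw [h2, h1]; exact reach_symm hr
  have := reach_closed (fun w => ∃ n, (G.ptr p f)^[n] w = z.1) ?_ hr' ⟨0, rfl⟩
  · obtain ⟨n, hn⟩ := this
    exact no_cycle hf z.1 z.2 n hn
  · rintro e ⟨he, hne⟩
    rw [hS] at he
    obtain ⟨w, rfl⟩ := he
    refine ⟨_, _, good_ends hf w, ?_⟩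
    constructor
    · rintro ⟨n, hn⟩
      cases n with
      | zero => exact absurd (congrArg f (Subtype.ext hn)) hne
      | succ n => exact ⟨n, hn⟩
    · rintro ⟨n, hn⟩
      exact ⟨n + 1, hn⟩

theorem good_ext {f' : {x // p x} → G.E} (hf : G.Good p f) (hf' : G.Good p f')
    (h : Set.range f = Set.range f') : f = f' := by
  by_contra hne
  obtain ⟨x, hx⟩ := Function.ne_iff.1 hne
  have step : ∀ x : {x // p x}, f x ≠ f' x →
      ∃ h : p (G.ptr p f x.1), f ⟨_, h⟩ ≠ f' ⟨_, h⟩ := by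
    intro x hx
    obtain ⟨z, hz⟩ : f x ∈ Set.range f' := h ▸ ⟨x, rfl⟩
    have hzx : z ≠ x := by rintro rfl; exact hx hz.symm
    have h1 := good_ends hf x
    have h2 := good_ends hf' z
    rw [hz, h1, Sym2.eq_iff] at h2
    rcases h2 with ⟨h2, _⟩ | ⟨_, h2⟩
    · exact absurd (Subtype.ext h2.symm) hzx
    · have h3 : p (G.ptr p f x.1) := h2 ▸ z.2
      have h4 : z = ⟨_, h3⟩ := Subtype.ext h2.symm
      refine ⟨h3, ?_⟩
      rw [← h4, hz]
      exact fun h => hzx (good_inj hf h)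
  have all : ∀ n, ∃ h : p ((G.ptr p f)^[n] x.1), f ⟨_, h⟩ ≠ f' ⟨_, h⟩ := by
    intro n
    induction n with
    | zero => exact ⟨x.2, hx⟩
    | succ n ih =>
      obtain ⟨h1, h2⟩ := ih
      simp only [Function.iterate_succ_apply']
      exact step ⟨_, h1⟩ h2
  obtain ⟨n, hn⟩ := hf x.1
  exact hn (all n).1

end good

theorem good_two (G : Multigraph) (u v : G.V) (huv : u ≠ v) (f : {x // x ≠ u ∧ x ≠ v} → G.E)
    (hf : G.Good _ f) (S : Finset G.E) (hS : (S : Set G.E) = Set.range f) :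
    G.IsTwoForest u v S := by
  classical
  have hu : ∀ n, (G.ptr _ f)^[n] u = u := fun n => Function.iterate_fixed (G.ptr_neg _ f u (by simp)) n
  have hv : ∀ n, (G.ptr _ f)^[n] v = v := fun n => Function.iterate_fixed (G.ptr_neg _ f v (by simp)) n
  refine ⟨good_forest hf S hS, ?_, ?_⟩
  · intro hr
    have hcl := reach_closed (fun w => ∃ n, (G.ptr _ f)^[n] w = u) ?_ hr ⟨0, rfl⟩
    · obtain ⟨n, hn⟩ := hcl
      exact huv (by rw [← hn, hv])
    · intro e he
      rw [hS] at he
      obtain ⟨w, rfl⟩ := he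
      refine ⟨_, _, good_ends hf w, ?_⟩
      constructor
      · rintro ⟨n, hn⟩
        cases n with
        | zero => exact absurd hn w.2.1
        | succ n => exact ⟨n, hn⟩
      · rintro ⟨n, hn⟩
        exact ⟨n + 1, hn⟩
  · intro x
    obtain ⟨n, hn⟩ := hf x
    have h := reach_symm (reach_iterate hf x n)
    rw [← hS] at h
    by_cases h1 : (G.ptr _ f)^[n] x = u
    · left; rwa [h1] at h
    · right
      have h2 : (G.ptr _ f)^[n] x = v := by
        by_contra h2; exact hn ⟨h1, h2⟩
      rwa [h2] at h

/-- `x` is joined to `u` or `v` by a walk of length `n` in `S`. -/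
def Lev (G : Multigraph) (u v : G.V) (S : Finset G.E) : ℕ → G.V → Prop
  | 0, x => x = u ∨ x = v
  | n + 1, x => ∃ e ∈ S, ∃ y, G.ends e = s(x, y) ∧ Lev G u v S n y

theorem exists_lev (G : Multigraph) (u v : G.V) (S : Finset G.E) {r x : G.V}
    (hr : r = u ∨ r = v) (h : G.Reach S r x) : ∃ n, G.Lev u v S n x := by
  induction h with
  | refl => exact ⟨0, hr⟩
  | tail _ h ih =>
    obtain ⟨e, he, h⟩ := h
    obtain ⟨n, hn⟩ := ih
    exact ⟨n + 1, e, he, _, by rw [h, Sym2.eq_swap], hn⟩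

theorem exists_good (G : Multigraph) (u v : G.V) (S : Finset G.E) (hS : G.IsTwoForest u v S) :
    ∃ f : {x // x ≠ u ∧ x ≠ v} → G.E, G.Good _ f ∧ (S : Set G.E) = Set.range f := by
  classical
  obtain ⟨hfor, hsep, hcov⟩ := hS
  have hlev : ∀ x, ∃ n, G.Lev u v S n x := by
    intro x
    rcases hcov x with h | h
    · exact exists_lev G u v S (Or.inl rfl) h
    · exact exists_lev G u v S (Or.inr rfl) h
  let d : G.V → ℕ := fun x => Nat.find (hlev x)
  have hd : ∀ x, G.Lev u v S (d x) x := fun x => Nat.find_spec (hlev x)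
  have hdle : ∀ x n, G.Lev u v S n x → d x ≤ n := fun x n h => Nat.find_min' (hlev x) h
  have hstep : ∀ x : {x // x ≠ u ∧ x ≠ v}, ∃ e ∈ S, ∃ y, G.ends e = s(x.1, y) ∧ d y < d x.1 := by
    intro x
    have h := hd x.1
    cases hdx : d x.1 with
    | zero =>
      rw [hdx] at h
      rcases h with h | h
      · exact absurd h x.2.1
      · exact absurd h x.2.2
    | succ n =>
      rw [hdx] at h
      obtain ⟨e, he, y, hy, hl⟩ := h
      exact ⟨e, he, y, hy, Nat.lt_succ_of_le (hdle y n hl)⟩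
  choose f hfS y hy hlt using hstep
  have hptr : ∀ x, G.ptr _ f x.1 = y x := by
    intro x
    rw [ptr_pos, oth_eq_iff]
    · exact hy x
    · intro h
      have := hlt x
      rw [← h] at this
      exact lt_irrefl _ this
  have hgood : G.Good _ f := by
    have key : ∀ k x, d x = k → ∃ n, ¬ (((G.ptr _ f)^[n] x) ≠ u ∧ ((G.ptr _ f)^[n] x) ≠ v) := by
      intro k
      induction k using Nat.strong_induction_on with
      | _ k ih =>
        intro x hx
        by_cases hp : x ≠ u ∧ x ≠ v
        · have h1 := hlt ⟨x, hp⟩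
          obtain ⟨n, hn⟩ := ih _ (hx ▸ h1) (y ⟨x, hp⟩) rfl
          refine ⟨n + 1, ?_⟩
          rw [Function.iterate_succ_apply, hptr ⟨x, hp⟩]
          exact hn
        · exact ⟨0, hp⟩
    exact fun x => key _ x rfl
  refine ⟨f, hgood, ?_⟩
  apply Set.Subset.antisymm
  · intro e he
    by_contra hne
    have hsub : Set.range f ⊆ (S : Set G.E) \ {e} := by
      rintro _ ⟨w, rfl⟩
      refine ⟨hfS w, ?_⟩
      intro h
      exact hne ⟨w, h⟩
    have hroot : ∀ x, G.Reach ((S : Set G.E) \ {e}) x u ∨ G.Reach ((S : Set G.E) \ {e}) x v := by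
      intro x
      obtain ⟨n, hn⟩ := hgood x
      have h := reach_mono hsub (reach_iterate hgood x n)
      by_cases h1 : (G.ptr _ f)^[n] x = u
      · left; rwa [h1] at h
      · right
        have h2 : (G.ptr _ f)^[n] x = v := by
          by_contra h2; exact hn ⟨h1, h2⟩
        rwa [h2] at h
    obtain ⟨a, b, hab⟩ : ∃ a b, G.ends e = s(a, b) := by
      induction h : G.ends e with
      | _ a b => exact ⟨a, b, rfl⟩
    have hT : (S : Set G.E) \ {e} ⊆ S := Set.sdiff_subset
    have hedge : G.Reach S a b := Relation.ReflTransGen.single ⟨e, he, hab⟩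
    rcases hroot a with ha | ha <;> rcases hroot b with hb | hb
    · exact hfor e he a b hab (ha.trans (reach_symm hb))
    · exact hsep (((reach_symm (reach_mono hT ha)).trans hedge).trans (reach_mono hT hb))
    · exact hsep (((reach_symm (reach_mono hT hb)).trans (reach_symm hedge)).trans (reach_mono hT ha))
    · exact hfor e he a b hab (ha.trans (reach_symm hb))
  · rintro _ ⟨w, rfl⟩
    exact hfS w

theorem card_good (G : Multigraph) (u v : G.V) (huv : u ≠ v) :
    Nat.card {f : {x // x ≠ u ∧ x ≠ v} → G.E // G.Good _ f} = G.twoForestCount u v := by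
  classical
  have hco : ∀ f : {x // x ≠ u ∧ x ≠ v} → G.E,
      ((Finset.univ.image f : Finset G.E) : Set G.E) = Set.range f := by
    intro f; simp
  apply Nat.card_eq_of_bijective
    (fun f => (⟨Finset.univ.image f.1, G.good_two u v huv f.1 f.2 _ (hco f.1)⟩ :
      {S : Finset G.E // G.IsTwoForest u v S}))
  constructor
  · intro f f' h
    apply Subtype.ext
    apply good_ext f.2 f'.2
    rw [← hco, ← hco]
    exact congrArg (fun S => ((S.1 : Finset G.E) : Set G.E)) h
  · rintro ⟨S, hS⟩
    obtain ⟨f, hf, h⟩ := G.exists_good u v S hS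
    refine ⟨⟨f, hf⟩, Subtype.ext (Finset.coe_injective ?_)⟩
    rw [h]
    exact hco f

end Multigraph

/-- Two-vertex case of the all-minors matrix tree theorem: for a finite connected
multigraph `X` with two fixed distinct vertices `u`, `v`, the determinant of the matrix
obtained from the Laplacian `Val(X) − A(X)` by deleting the rows and columns indexed by
`u` and `v` equals the number of spanning 2-forests of `X` consisting of two trees, one
containing `u` and the other containing `v`. -/
theorem stmt_13 (G : Multigraph) (hG : G.Connected) (u v : G.V) (huv : u ≠ v) :
    (G.lapMatrix.submatrix (Subtype.val : {x : G.V // x ≠ u ∧ x ≠ v} → G.V)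
        (Subtype.val : {x : G.V // x ≠ u ∧ x ≠ v} → G.V)).det =
      (G.twoForestCount u v : ℤ) := by
  rw [← G.card_good u v huv, ← G.det_eq_card]
  congr!
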